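/- Let ρ be a nonzero, finite, symmetric, nonnegative Borel measure on ℝ. Then there exists τ ∈ (0, ∞) such that for all k ∈ ℕ: m_{−2k+2}(ρ) ≤ τ · m_{−2k}(ρ), where the inequality is understood in the extended nonnegative reals. -/

import Mathlib

open MeasureTheory Real Set
open scoped ENNReal

/-- The `d`-th absolute moment `m_d(ρ) = ∫ |λ|^d dρ(λ)`, valued in `[0,∞]`. -/
noncomputable def specMom (ρ : Measure ℝ) (d : ℝ) : ℝ≥0∞ :=
  ∫⁻ l, (ENNReal.ofReal |l|) ^ d ∂ρ

lemma exists_R (ρ : Measure ℝ) [IsFiniteMeasure ρ] (hρ : ρ ≠ 0) :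
    ∃ R : ℝ, 0 < R ∧ ρ {l : ℝ | |l| ≤ R}ᶜ ≤ ρ {l : ℝ | |l| ≤ R} := by
  have hm : Monotone (fun n : ℕ => {l : ℝ | |l| ≤ (n : ℝ)}) := by
    intro a b hab l hl
    have h : (a : ℝ) ≤ b := by exact_mod_cast hab
    exact le_trans (show |l| ≤ (a : ℝ) from hl) h
  have ht := tendsto_measure_iUnion_atTop (μ := ρ) hm
  have hu : (⋃ n : ℕ, {l : ℝ | |l| ≤ (n : ℝ)}) = univ := by
    ext l
    simp only [mem_iUnion, mem_ofPred_eq, mem_univ, iff_true]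
    exact exists_nat_ge _
  rw [hu] at ht
  have h0 : ρ univ ≠ 0 := by simpa using hρ
  have hlt : ρ univ / 2 < ρ univ := ENNReal.half_lt_self h0 (measure_ne_top _ _)
  obtain ⟨n, hn1, hn⟩ := ((ht.eventually (lt_mem_nhds hlt)).and
    (Filter.eventually_ge_atTop 1)).exists
  refine ⟨n, by exact_mod_cast hn, ?_⟩
  have hmeas : MeasurableSet {l : ℝ | |l| ≤ (n : ℝ)} :=
    measurableSet_le (by fun_prop) (by fun_prop)
  rw [measure_compl hmeas (measure_ne_top _ _), tsub_le_iff_right]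
  simp only [Function.comp_apply] at hn1
  calc ρ univ = ρ univ / 2 + ρ univ / 2 := (ENNReal.add_halves _).symm
    _ ≤ _ := add_le_add hn1.le hn1.le

lemma ptwise (a r : ℝ≥0∞) (d : ℝ) (har : a ≤ r) (hr0 : r ≠ 0) (hr : r ≠ ⊤) (hd : d < 0) :
    a ^ (d + 2) ≤ r ^ (2 : ℝ) * a ^ d := by
  rcases eq_or_ne a 0 with rfl | h0
  · rw [ENNReal.zero_rpow_of_neg hd, ENNReal.mul_top]
    · exact le_top
    · simp [hr0]
  · rw [ENNReal.rpow_add _ _ h0 (ne_top_of_le_ne_top hr har), mul_comm]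
    gcongr

/-- For any nonzero, finite, symmetric, nonnegative Borel measure `ρ` on `ℝ`, there is
`τ ∈ (0,∞)` such that `m_{-2k+2}(ρ) ≤ τ · m_{-2k}(ρ)` for all `k ∈ ℕ`, the inequality
being understood in `[0,∞]`. -/
theorem statement15 (ρ : Measure ℝ) [IsFiniteMeasure ρ] (hρ : ρ ≠ 0)
    (hsymm : ρ.map (fun x => -x) = ρ) :
    ∃ τ : ℝ, 0 < τ ∧
      ∀ k : ℕ, 1 ≤ k →
        specMom ρ (-(2 * k : ℝ) + 2) ≤ ENNReal.ofReal τ * specMom ρ (-(2 * k : ℝ)) := by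
  obtain ⟨R, hR, hle⟩ := exists_R ρ hρ
  refine ⟨2 * R ^ 2, by positivity, fun k hk => ?_⟩
  have hk' : (1 : ℝ) ≤ k := by exact_mod_cast hk
  have hmeas : MeasurableSet {l : ℝ | |l| ≤ R} :=
    measurableSet_le (by fun_prop) (by fun_prop)
  have hτ : ENNReal.ofReal (2 * R ^ 2) = 2 * (ENNReal.ofReal R) ^ (2 : ℝ) := by
    rw [ENNReal.ofReal_mul (by norm_num), ENNReal.ofReal_pow hR.le]
    norm_num
  have hr0 : ENNReal.ofReal R ≠ 0 := by simpa using hR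
  have hd : -(2 * k : ℝ) + 2 ≤ 0 := by linarith
  have anti : ∀ a b : ℝ≥0∞, a ≤ b →
      b ^ (-(2 * k : ℝ) + 2) ≤ a ^ (-(2 * k : ℝ) + 2) := by
    intro a b hab
    rw [← neg_neg (-(2 * k : ℝ) + 2), ENNReal.rpow_neg, ENNReal.rpow_neg a]
    exact ENNReal.inv_le_inv.mpr (ENNReal.rpow_le_rpow hab (by linarith))
  unfold specMom
  rw [← lintegral_add_compl _ hmeas, hτ]
  set S := {l : ℝ | |l| ≤ R} with hS
  have h1 : ∫⁻ l in Sᶜ, (ENNReal.ofReal |l|) ^ (-(2 * k : ℝ) + 2) ∂ρ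
      ≤ ∫⁻ l in S, (ENNReal.ofReal |l|) ^ (-(2 * k : ℝ) + 2) ∂ρ := by
    calc _ ≤ ∫⁻ l in Sᶜ, (ENNReal.ofReal R) ^ (-(2 * k : ℝ) + 2) ∂ρ := by
          refine setLIntegral_mono' hmeas.compl fun l hl => anti _ _ ?_
          exact ENNReal.ofReal_le_ofReal (not_le.mp (show ¬ |l| ≤ R from hl)).le
      _ ≤ ∫⁻ l in S, (ENNReal.ofReal R) ^ (-(2 * k : ℝ) + 2) ∂ρ := by
          rw [setLIntegral_const, setLIntegral_const]
          gcongr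
      _ ≤ _ := by
          refine setLIntegral_mono' hmeas fun l hl => anti _ _ ?_
          exact ENNReal.ofReal_le_ofReal hl
  have h2 : ∫⁻ l in S, (ENNReal.ofReal |l|) ^ (-(2 * k : ℝ) + 2) ∂ρ
      ≤ (ENNReal.ofReal R) ^ (2 : ℝ) * ∫⁻ l, (ENNReal.ofReal |l|) ^ (-(2 * k : ℝ)) ∂ρ := by
    rw [← lintegral_const_mul _ (by fun_prop)]
    refine le_trans (setLIntegral_mono' hmeas fun l hl => ?_) (setLIntegral_le_lintegral S _)
    exact ptwise _ _ _ (ENNReal.ofReal_le_ofReal hl) hr0 ENNReal.ofReal_ne_top (by linarith)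
  rw [mul_assoc, two_mul (_ * _ : ℝ≥0∞)]
  exact add_le_add h2 (h1.trans h2)
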